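/- arXiv:1805.12479 — 2 statements merged into one kernel-verified Lean document; each statement's English description precedes it below -/
import Mathlib

section
/- Let H be a separable infinite-dimensional real Hilbert space and let 0 < t ≤ 1. Then there exist a group homomorphism ρ : O₊(B) → O₊(B) and a map f : ℋ(H) → ℋ(H) such that: (1) B(f(x), f(y)) = (B(x,y))^t for all x,y ∈ ℋ(H) (equivalently cosh d(f(x), f(y)) = (cosh d(x,y))^t); (2) f is ρ-equivariant, i.e. f(g·x) = ρ(g)·f(x) for all g ∈ O₊(B) and x ∈ ℋ(H); (3) the image f(ℋ(H)) is hyperbolically total in ℋ(H). -/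
open scoped RealInnerProductSpace

variable (H : Type*) [NormedAddCommGroup H] [InnerProductSpace ℝ H]

/-- The Minkowski bilinear form on `ℝ × H`. -/
noncomputable def minkB (v w : ℝ × H) : ℝ := v.1 * w.1 - ⟪v.2, w.2⟫

/-- The hyperboloid model of hyperbolic space inside `ℝ × H`. -/
noncomputable def Hyp : Set (ℝ × H) := {v | minkB H v v = 1 ∧ 0 < v.1}

/-- Inverse hyperbolic cosine. -/
noncomputable def arcosh (x : ℝ) : ℝ := Real.log (x + Real.sqrt (x ^ 2 - 1))

/-- The hyperbolic distance on the hyperboloid. -/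
noncomputable def hypDist (x y : ℝ × H) : ℝ := arcosh (minkB H x y)

/-- A subset of the hyperboloid is hyperbolically total if its closed linear span
is all of `ℝ × H`. -/
def HypTotal (S : Set (ℝ × H)) : Prop :=
  (Submodule.span ℝ S).topologicalClosure = ⊤

/-- A kernel of hyperbolic type. -/
def IsHypKernel {X : Type*} (β : X → X → ℝ) : Prop :=
  (∀ x y, β x y = β y x) ∧ (∀ x y, 0 ≤ β x y) ∧ (∀ x, β x x = 1) ∧
    ∀ (n : ℕ) (x₀ : X) (x : Fin n → X) (c : Fin n → ℝ),
      ∑ i, ∑ j, c i * c j * β (x i) (x j) ≤ (∑ k, c k * β (x k) x₀) ^ 2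

/-- A kernel of conditionally negative type. -/
def IsCNDKernel {X : Type*} (ψ : X → X → ℝ) : Prop :=
  (∀ x y, ψ x y = ψ y x) ∧ (∀ x, ψ x x = 0) ∧
    ∀ (n : ℕ) (x : Fin n → X) (c : Fin n → ℝ), (∑ i, c i = 0) →
      ∑ i, ∑ j, c i * c j * ψ (x i) (x j) ≤ 0

/-- The group `O₊(B)` of continuous linear automorphisms of `ℝ × H` preserving the
Minkowski form and the upper hyperboloid sheet. -/
noncomputable def Oplus : Subgroup ((ℝ × H) ≃L[ℝ] (ℝ × H)) where
  carrier := {g | (∀ v w, minkB H (g v) (g w) = minkB H v w) ∧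
    ∀ v, v ∈ Hyp H ↔ g v ∈ Hyp H}
  one_mem' := ⟨fun _ _ => rfl, fun _ => Iff.rfl⟩
  mul_mem' := by
    rintro a b ⟨ha1, ha2⟩ ⟨hb1, hb2⟩
    refine ⟨fun v w => ?_, fun v => ?_⟩
    · show minkB H (a (b v)) (a (b w)) = _
      rw [ha1, hb1]
    · show v ∈ Hyp H ↔ a (b v) ∈ Hyp H
      rw [← ha2, ← hb2]
  inv_mem' := by
    rintro a ⟨ha1, ha2⟩
    refine ⟨fun v w => ?_, fun v => ?_⟩
    · show minkB H (a.symm v) (a.symm w) = minkB H v w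
      conv_rhs => rw [← a.apply_symm_apply v, ← a.apply_symm_apply w, ha1]
    · show v ∈ Hyp H ↔ a.symm v ∈ Hyp H
      conv_lhs => rw [← a.apply_symm_apply v, ← ha2]

section

open TopologicalSpace

variable {H}

namespace Real

theorem succ_mul_ringChoose_succ (t : ℝ) (n : ℕ) :
    (n + 1 : ℝ) * Ring.choose t (n + 1) = (t - n) * Ring.choose t n := by
  have h : (n.factorial : ℝ) ≠ 0 := by positivity
  have h' : (n + 1 : ℝ) ≠ 0 := by positivity
  rw [Ring.choose_eq_smul, Ring.choose_eq_smul, descPochhammer_succ_right,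
    Polynomial.smeval_mul, Polynomial.smeval_sub, Polynomial.smeval_X, Polynomial.smeval_natCast,
    Nat.factorial_succ]
  push_cast
  simp only [smul_eq_mul, pow_one, pow_zero, nsmul_eq_mul, mul_one]
  field_simp

theorem neg_one_pow_mul_ringChoose_succ_nonneg {t : ℝ} (ht0 : 0 ≤ t) (ht1 : t ≤ 1) (n : ℕ) :
    0 ≤ (-1) ^ n * Ring.choose t (n + 1) := by
  induction n with
  | zero => simpa using ht0
  | succ n ih =>
    have h := succ_mul_ringChoose_succ t (n + 1)
    push_cast at h
    have hn : (0 : ℝ) ≤ n := n.cast_nonneg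
    have key : ((n : ℝ) + 1 + 1) * ((-1) ^ (n + 1) * Ring.choose t (n + 1 + 1)) =
        (n + 1 - t) * ((-1) ^ n * Ring.choose t (n + 1)) := by
      rw [mul_left_comm, h]; ring
    have : 0 ≤ ((n : ℝ) + 1 + 1) * ((-1) ^ (n + 1) * Ring.choose t (n + 1 + 1)) := by
      rw [key]; exact mul_nonneg (by linarith) ih
    exact nonneg_of_mul_nonneg_right this (by positivity)

theorem hasSum_one_sub_one_sub_rpow (t : ℝ) {u : ℝ} (hu : |u| < 1) :
    HasSum (fun n : ℕ ↦ ((-1) ^ n * Ring.choose t (n + 1)) * u ^ (n + 1)) (1 - (1 - u) ^ t) := by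
  have h := (Real.one_add_rpow_hasFPowerSeriesOnBall_zero (a := t)).hasSum (y := -u)
    (by simpa [enorm_eq_nnnorm, ← NNReal.coe_lt_coe] using hu)
  simp only [binomialSeries_apply, List.ofFn_const, List.prod_replicate, smul_eq_mul] at h
  rw [← hasSum_nat_add_iff' 1] at h
  simp only [Finset.sum_range_one, Ring.choose_zero_right, pow_zero, mul_one] at h
  rw [zero_add, ← sub_eq_add_neg] at h
  rw [← neg_sub _ (1 : ℝ)]
  refine h.neg.congr_fun fun n ↦ ?_
  rw [neg_pow u]
  ring

end Real

namespace Matrix.PosSemidef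

variable {X : Type*}

theorem of_hasSum {M : ℕ → Matrix X X ℝ} {N : Matrix X X ℝ} (hM : ∀ n, (M n).PosSemidef)
    (h : ∀ x y, HasSum (fun n ↦ M n x y) (N x y)) : N.PosSemidef := by
  refine ⟨?_, fun c ↦ ?_⟩
  · ext x y
    have h' : HasSum (fun n ↦ M n y x) (N x y) :=
      (h x y).congr_fun fun n ↦ (hM n).isHermitian.apply x y
    have h_eq : N y x = N x y := (h y x).unique h'
    exact h_eq
  · have h_sum : HasSum
        (fun n ↦ c.sum fun i xi ↦ c.sum fun j xj ↦ star xi * M n i j * xj)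
        (c.sum fun i xi ↦ c.sum fun j xj ↦ star xi * N i j * xj) :=
      hasSum_sum fun i _ ↦ hasSum_sum fun j _ ↦ ((h i j).mul_left _).mul_right _
    exact h_sum.nonneg fun n ↦ (hM n).2 c

theorem inner_pow {E : Type*} [NormedAddCommGroup E] [InnerProductSpace ℝ E] (v : X → E) (n : ℕ) :
    (Matrix.of fun x y ↦ ⟪v x, v y⟫ ^ (n + 1) : Matrix X X ℝ).PosSemidef := by
  have h1 : (Matrix.of fun x y ↦ ⟪v x, v y⟫ : Matrix X X ℝ).PosSemidef := by
    refine ⟨?_, fun c ↦ ?_⟩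
    · ext x y
      exact real_inner_comm _ _
    · have : (0 : ℝ) ≤ ⟪c.sum fun x a ↦ a • v x, c.sum fun x a ↦ a • v x⟫ := real_inner_self_nonneg
      simp only [Finsupp.sum_inner, Finsupp.inner_sum, inner_smul_left, inner_smul_right] at this
      refine this.trans_eq ?_
      unfold Finsupp.sum
      refine Finset.sum_congr rfl fun i _ ↦ ?_
      simp only [Matrix.of_apply, star_trivial, Finset.mul_sum]
      refine Finset.sum_congr rfl fun j _ ↦ ?_
      rw [conj_trivial, real_inner_comm]
      ring
  induction n with
  | zero => simpa using h1
  | succ n ih =>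
    have h := ih.hadamard h1
    simp only [pow_succ _ (n + 1)]
    exact h

theorem mul_mul_self {M : Matrix X X ℝ} (hM : M.PosSemidef) (a : X → ℝ) :
    (Matrix.of fun x y ↦ a x * a y * M x y : Matrix X X ℝ).PosSemidef := by
  have h := inner_pow a 0
  simp only [zero_add, pow_one, RCLike.inner_apply', conj_trivial] at h
  exact h.hadamard hM

universe u in
theorem exists_feature_map {X : Type u} {M : Matrix X X ℝ} (hM : M.PosSemidef) :
    ∃ (E : Type u) (_ : NormedAddCommGroup E) (_ : InnerProductSpace ℝ E) (_ : CompleteSpace E)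
      (φ : X → E), (∀ x y, ⟪φ x, φ y⟫ = M x y) ∧
        (Submodule.span ℝ (Set.range φ)).topologicalClosure = ⊤ := by
  let K : Matrix X X (ℝ →L[ℝ] ℝ) := .of fun x y ↦ M x y • ContinuousLinearMap.id ℝ ℝ
  have hK : K.PosSemidef := by
    have h := ((RKHS.posSemidef_tfae (𝕜 := ℝ) (K := K)).out 0 2).mpr
    refine h ⟨?_, fun c ↦ ?_⟩
    · ext x y
      have := hM.isHermitian.apply x y
      simp only [star_trivial] at this
      simp [K, this, ← ContinuousLinearMap.one_def]
    · rw [Finsupp.sum_comm]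
      refine (hM.2 c).trans_eq ?_
      simp [K, Finsupp.sum, mul_assoc]
  have : Fact K.PosSemidef := ⟨hK⟩
  refine ⟨RKHS.OfKernel K, inferInstance, inferInstance, inferInstance,
    fun x ↦ RKHS.kerFun (RKHS.OfKernel K) x 1, fun x y ↦ ?_, ?_⟩
  · rw [← RKHS.kernel_inner, RKHS.OfKernel.kernel_ofKernel]
    have := hM.isHermitian.apply x y
    simp only [star_trivial] at this
    simp [K, this]
  · rw [← top_le_iff, ← RKHS.kerFun_dense (RKHS.OfKernel K)]
    refine Submodule.topologicalClosure_mono (Submodule.span_le.mpr ?_)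
    rintro _ ⟨x, a, rfl⟩
    have : RKHS.kerFun (RKHS.OfKernel K) x a = a • RKHS.kerFun (RKHS.OfKernel K) x 1 := by
      rw [← map_smul, smul_eq_mul, mul_one]
    rw [this]
    exact Submodule.smul_mem _ _ (Submodule.subset_span ⟨x, rfl⟩)

end Matrix.PosSemidef

section HilbertBasis

variable {E F : Type*} [NormedAddCommGroup E] [InnerProductSpace ℝ E]
  [NormedAddCommGroup F] [InnerProductSpace ℝ F]

theorem Orthonormal.countable [SeparableSpace E] {ι : Type*} {v : ι → E} (hv : Orthonormal ℝ v) :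
    Countable ι := by
  rw [← Set.countable_univ_iff]
  refine Set.PairwiseDisjoint.countable_of_isOpen (s := fun i ↦ Metric.ball (v i) (1 / 2))
    ?_ (fun _ _ ↦ Metric.isOpen_ball) (fun i _ ↦ ⟨v i, Metric.mem_ball_self (by norm_num)⟩)
  intro i _ j _ hij
  refine Metric.ball_disjoint_ball ?_
  have h : dist (v i) (v j) ^ 2 = 2 := by
    rw [dist_eq_norm, norm_sub_sq_real, hv.1, hv.1, hv.2 hij]
    norm_num
  nlinarith [dist_nonneg (x := v i) (y := v j)]

theorem HilbertBasis.infinite {ι : Type*} (b : HilbertBasis ι ℝ E)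
    (hE : ¬ FiniteDimensional ℝ E) : Infinite ι := by
  by_contra h
  rw [not_infinite_iff_finite] at h
  refine hE ?_
  have hfin : FiniteDimensional ℝ (Submodule.span ℝ (Set.range b)) :=
    FiniteDimensional.span_of_finite ℝ (Set.finite_range b)
  have hd := b.dense_span
  rw [(Submodule.closed_of_finiteDimensional _).submodule_topologicalClosure_eq] at hd
  rw [hd] at hfin
  exact Module.finite_def.mpr (Module.Finite.iff_fg.mp hfin)

theorem exists_hilbertBasis_nat [CompleteSpace E] [SeparableSpace E]
    (hE : ¬ FiniteDimensional ℝ E) : Nonempty (HilbertBasis ℕ ℝ E) := by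
  obtain ⟨w, b, -⟩ := exists_hilbertBasis ℝ E
  have := b.orthonormal.countable
  have := b.infinite hE
  obtain ⟨e⟩ := nonempty_equiv_of_countable (α := ℕ) (β := w)
  refine ⟨HilbertBasis.mk (b.orthonormal.comp e e.injective) ?_⟩
  rw [e.surjective.range_comp, b.dense_span]

theorem nonempty_linearIsometryEquiv_of_separable [CompleteSpace E] [SeparableSpace E]
    [CompleteSpace F] [SeparableSpace F]
    (hE : ¬ FiniteDimensional ℝ E) (hF : ¬ FiniteDimensional ℝ F) : Nonempty (E ≃ₗᵢ[ℝ] F) := by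
  obtain ⟨b⟩ := exists_hilbertBasis_nat hE
  obtain ⟨c⟩ := exists_hilbertBasis_nat hF
  exact ⟨b.repr.trans c.repr.symm⟩

end HilbertBasis

section Minkowski

theorem minkB_comm (v w : ℝ × H) : minkB H v w = minkB H w v := by
  simp only [minkB, real_inner_comm w.2 v.2, mul_comm]

theorem minkB_add_left (u v w : ℝ × H) : minkB H (u + v) w = minkB H u w + minkB H v w := by
  simp only [minkB, Prod.fst_add, Prod.snd_add, inner_add_left]; ring

theorem minkB_smul_left (a : ℝ) (v w : ℝ × H) : minkB H (a • v) w = a * minkB H v w := by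
  simp only [minkB, Prod.smul_fst, Prod.smul_snd, inner_smul_left, conj_trivial, smul_eq_mul]; ring

theorem minkB_one_zero (v : ℝ × H) : minkB H v (1, 0) = v.1 := by
  simp [minkB]

@[fun_prop]
theorem Continuous.minkB {X : Type*} [TopologicalSpace X] {f g : X → ℝ × H} (hf : Continuous f)
    (hg : Continuous g) : Continuous fun x ↦ minkB H (f x) (g x) := by
  unfold _root_.minkB; fun_prop

theorem one_zero_mem_Hyp : ((1, 0) : ℝ × H) ∈ Hyp H := by
  simp [Hyp, minkB]

theorem norm_lt_fst_of_mem_Hyp {x : ℝ × H} (hx : x ∈ Hyp H) : ‖x.2‖ < x.1 := by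
  obtain ⟨h1, h2⟩ := hx
  rw [minkB, real_inner_self_eq_norm_sq] at h1
  nlinarith [norm_nonneg x.2]

theorem minkB_pos {x y : ℝ × H} (hx : x ∈ Hyp H) (hy : y ∈ Hyp H) : 0 < minkB H x y := by
  rw [minkB, sub_pos]
  exact (real_inner_le_norm _ _).trans_lt
    (mul_lt_mul'' (norm_lt_fst_of_mem_Hyp hx) (norm_lt_fst_of_mem_Hyp hy)
      (norm_nonneg _) (norm_nonneg _))

theorem norm_sq_le_minkB (v : ℝ × H) : ‖v‖ ^ 2 ≤ 2 * v.1 ^ 2 - minkB H v v := by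
  rw [minkB, real_inner_self_eq_norm_sq, Prod.norm_def]
  rcases max_cases ‖v.1‖ ‖v.2‖ with ⟨h, -⟩ | ⟨h, -⟩ <;> rw [h]
  · rw [Real.norm_eq_abs, sq_abs]; nlinarith [sq_nonneg ‖v.2‖]
  · nlinarith [sq_nonneg v.1]

theorem abs_minkB_le (v w : ℝ × H) : |minkB H v w| ≤ 2 * (‖v‖ * ‖w‖) := by
  have h1 : |v.1 * w.1| ≤ ‖v‖ * ‖w‖ := by
    rw [abs_mul]
    exact mul_le_mul (norm_fst_le v) (norm_fst_le w) (abs_nonneg _) (norm_nonneg _)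
  have h2 : |⟪v.2, w.2⟫| ≤ ‖v‖ * ‖w‖ := (abs_real_inner_le_norm _ _).trans
    (mul_le_mul (norm_snd_le v) (norm_snd_le w) (norm_nonneg _) (norm_nonneg _))
  rw [minkB]
  linarith [abs_sub (v.1 * w.1) ⟪v.2, w.2⟫]

theorem abs_inner_inv_smul_lt_one {x y : ℝ × H} (hx : x ∈ Hyp H) (hy : y ∈ Hyp H) :
    |⟪x.1⁻¹ • x.2, y.1⁻¹ • y.2⟫| < 1 := by
  have aux {z : ℝ × H} (hz : z ∈ Hyp H) : ‖z.1⁻¹ • z.2‖ < 1 := by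
    rw [norm_smul, norm_inv, Real.norm_of_nonneg hz.2.le, inv_mul_lt_one₀ hz.2]
    exact norm_lt_fst_of_mem_Hyp hz
  refine (abs_real_inner_le_norm _ _).trans_lt ?_
  exact mul_lt_one_of_nonneg_of_lt_one_left (norm_nonneg _) (aux hx) (aux hy).le

theorem minkB_rpow_eq {x y : ℝ × H} (hx : x ∈ Hyp H) (hy : y ∈ Hyp H) (t : ℝ) :
    minkB H x y ^ t = x.1 ^ t * y.1 ^ t * (1 - ⟪x.1⁻¹ • x.2, y.1⁻¹ • y.2⟫) ^ t := by
  have hxy := abs_lt.mp (abs_inner_inv_smul_lt_one hx hy)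
  have hx' := hx.2
  have hy' := hy.2
  rw [← Real.mul_rpow hx'.le hy'.le, ← Real.mul_rpow (by positivity) (by linarith [hxy.2])]
  congr 1
  rw [minkB, inner_smul_left, inner_smul_right, conj_trivial]
  field_simp

variable (H) in
/-- The power of the Minkowski form, with the sign and the normalization that make it a kernel of
positive type on the hyperboloid. -/
noncomputable def powKernel (t : ℝ) :
    Matrix (Hyp H) (Hyp H) ℝ :=
  .of fun x y ↦ x.1.1 ^ t * y.1.1 ^ t - minkB H x y ^ t

theorem posSemidef_powKernel {t : ℝ} (ht0 : 0 ≤ t) (ht1 : t ≤ 1) :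
    (powKernel H t).PosSemidef := by
  have h : (Matrix.of fun x y : Hyp H ↦
      1 - (1 - ⟪x.1.1⁻¹ • x.1.2, y.1.1⁻¹ • y.1.2⟫) ^ t : Matrix (Hyp H) (Hyp H) ℝ).PosSemidef :=
    .of_hasSum
      (fun n ↦ (Matrix.PosSemidef.inner_pow (fun x : Hyp H ↦ x.1.1⁻¹ • x.1.2) n).smul
        (Real.neg_one_pow_mul_ringChoose_succ_nonneg ht0 ht1 n))
      fun x y ↦ Real.hasSum_one_sub_one_sub_rpow t (abs_inner_inv_smul_lt_one x.2 y.2)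
  convert h.mul_mul_self fun x ↦ x.1.1 ^ t using 1
  ext x y
  simp only [powKernel, Matrix.of_apply, minkB_rpow_eq x.2 y.2]
  ring

theorem continuous_of_inner_eq_powKernel {E : Type*} [NormedAddCommGroup E]
    [InnerProductSpace ℝ E] {t : ℝ} (ht0 : 0 ≤ t) {φ : Hyp H → E}
    (hφ : ∀ x y, ⟪φ x, φ y⟫ = powKernel H t x y) : Continuous φ := by
  have hc : Continuous fun p : Hyp H × Hyp H ↦ powKernel H t p.1 p.2 := by
    simp only [powKernel, Matrix.of_apply]
    refine .sub (.mul ?_ ?_) ?_ <;>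
    exact Continuous.rpow_const (by fun_prop) fun _ ↦ Or.inr ht0
  rw [continuous_iff_continuousAt]
  intro x
  rw [ContinuousAt, tendsto_iff_dist_tendsto_zero]
  have h : Continuous fun y ↦ √(powKernel H t y y - 2 * powKernel H t y x + powKernel H t x x) := by
    have h1 := hc.comp (continuous_id.prodMk continuous_id)
    have h2 := hc.comp (continuous_id.prodMk (continuous_const (y := x)))
    simp only [Function.comp_def, id] at h1 h2
    fun_prop
  have heq : (fun y ↦ dist (φ y) (φ x)) =
      fun y ↦ √(powKernel H t y y - 2 * powKernel H t y x + powKernel H t x x) := by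
    ext y
    rw [← hφ, ← hφ, ← hφ, dist_eq_norm, real_inner_self_eq_norm_sq, real_inner_self_eq_norm_sq,
      ← norm_sub_sq_real, Real.sqrt_sq (norm_nonneg _)]
  rw [← heq] at h
  simpa only [dist_self] using h.tendsto x

theorem sqrt_two_mem_Hyp {e : H} (he : ‖e‖ = 1) : ((√2, e) : ℝ × H) ∈ Hyp H := by
  refine ⟨?_, by positivity⟩
  simp only [minkB, real_inner_self_eq_norm_sq, he]
  norm_num

theorem not_finiteDimensional_of_inner_eq_powKernel [CompleteSpace H]
    (hinf : ¬ FiniteDimensional ℝ H) {E : Type*} [NormedAddCommGroup E]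
    [InnerProductSpace ℝ E] {t : ℝ} (ht0 : 0 < t) {φ : Hyp H → E}
    (hφ : ∀ x y, ⟪φ x, φ y⟫ = powKernel H t x y) : ¬ FiniteDimensional ℝ E := by
  intro hE
  obtain ⟨w, b, -⟩ := exists_hilbertBasis ℝ H
  have := b.infinite hinf
  let x (i : w) : Hyp H := ⟨(√2, b i), sqrt_two_mem_Hyp (b.orthonormal.1 i)⟩
  have hk (i j : w) : powKernel H t (x i) (x j) = 2 ^ t - (2 - ⟪b i, b j⟫) ^ t := by
    simp only [powKernel, Matrix.of_apply, x, minkB]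
    rw [← Real.mul_rpow (by positivity) (by positivity), Real.mul_self_sqrt (by norm_num)]
  have hli : LinearIndependent ℝ (fun i ↦ φ (x i)) := by
    refine linearIndependent_of_ne_zero_of_inner_eq_zero (fun i hi ↦ ?_) fun i j hij ↦ ?_
    · have h := hφ (x i) (x i)
      rw [hi, inner_zero_left, hk, real_inner_self_eq_norm_sq, b.orthonormal.1 i] at h
      norm_num at h
      linarith [Real.one_lt_rpow (x := 2) (by norm_num) ht0]
    · simp only [hφ, hk, b.orthonormal.2 hij, sub_zero, sub_self]
  exact not_finite_iff_infinite.mpr this hli.finite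

theorem exists_powKernel_feature_map [CompleteSpace H] [SeparableSpace H]
    (hinf : ¬ FiniteDimensional ℝ H) {t : ℝ} (ht0 : 0 < t) (ht1 : t ≤ 1) :
    ∃ φ : Hyp H → H, (∀ x y, ⟪φ x, φ y⟫ = powKernel H t x y) ∧
      (Submodule.span ℝ (Set.range φ)).topologicalClosure = ⊤ := by
  obtain ⟨E, _, _, _, φ, hφ, hspan⟩ :=
    (posSemidef_powKernel (H := H) ht0.le ht1).exists_feature_map
  have hsep : SeparableSpace E := by
    have : SecondCountableTopology H := UniformSpace.secondCountable_of_separable H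
    have h := (isSeparable_range (continuous_of_inner_eq_powKernel ht0.le hφ)).span (R := ℝ)
    have h' := h.closure
    rw [← Submodule.topologicalClosure_coe, hspan, Submodule.top_coe] at h'
    exact isSeparable_univ_iff.mp h'
  obtain ⟨U⟩ := nonempty_linearIsometryEquiv_of_separable
    (not_finiteDimensional_of_inner_eq_powKernel hinf ht0 hφ) hinf
  refine ⟨U ∘ φ, fun x y ↦ by simp [hφ], ?_⟩
  rw [Set.range_comp]
  have h := U.surjective.denseRange.topologicalClosure_map_submodule
    (f := (U.toContinuousLinearEquiv : E →L[ℝ] H)) hspan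
  rwa [Submodule.map_span] at h

variable (H) in
/-- The Minkowski form as a bilinear map. -/
noncomputable def minkBilin : (ℝ × H) →ₗ[ℝ] (ℝ × H) →ₗ[ℝ] ℝ :=
  LinearMap.mk₂ ℝ (minkB H) minkB_add_left (fun a v w ↦ minkB_smul_left a v w)
    (fun u v w ↦ by simp only [minkB_comm u, minkB_add_left])
    (fun a v w ↦ by simp only [minkB_comm v, minkB_smul_left, smul_eq_mul])

theorem minkBilin_apply (v w : ℝ × H) : minkBilin H v w = minkB H v w := rfl

/-- A map from a total family to another family with the same Minkowski Gram matrix extends to a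
continuous linear map as soon as the time coordinate on the target is represented on the source. -/
theorem exists_continuousLinearMap_of_minkB_eq [CompleteSpace H] {X : Type*} {f f' : X → ℝ × H}
    (hf : HypTotal H (Set.range f)) (hB : ∀ x y, minkB H (f' x) (f' y) = minkB H (f x) (f y))
    {w : ℝ × H} (hw : ∀ x, (f' x).1 = minkB H (f x) w) :
    ∃ T : (ℝ × H) →L[ℝ] (ℝ × H), ∀ x, T (f x) = f' x := by
  let L : (X →₀ ℝ) →ₗ[ℝ] ℝ × H := Finsupp.linearCombination ℝ f
  let L' : (X →₀ ℝ) →ₗ[ℝ] ℝ × H := Finsupp.linearCombination ℝ f'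
  have hLB : (minkBilin H).compl₁₂ L' L' = (minkBilin H).compl₁₂ L L := by
    ext x y
    simp [L, L', minkBilin_apply, hB]
  have hLw : LinearMap.fst ℝ ℝ H ∘ₗ L' = (minkBilin H).flip w ∘ₗ L := by
    ext x
    simp [L, L', minkBilin_apply, hw]
  have hdense : DenseRange L := by
    rw [HypTotal, ← Submodule.dense_iff_topologicalClosure_eq_top,
      ← Finsupp.range_linearCombination] at hf
    exact hf
  have hnorm (c : X →₀ ℝ) : ‖L' c‖ ≤ √(8 * ‖w‖ ^ 2 + 2) * ‖L c‖ := by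
    refine le_of_sq_le_sq ?_ (by positivity)
    have h1 : minkB H (L' c) (L' c) = minkB H (L c) (L c) := LinearMap.congr_fun₂ hLB c c
    have h2 : (L' c).1 = minkB H (L c) w := LinearMap.congr_fun hLw c
    have h3 := norm_sq_le_minkB (L' c)
    have h4 := (abs_le.mp (abs_minkB_le (L c) (L c))).1
    have h5 := sq_le_sq' (abs_le.mp (abs_minkB_le (L c) w)).1 (abs_le.mp (abs_minkB_le (L c) w)).2
    rw [h1, h2] at h3
    rw [mul_pow, Real.sq_sqrt (by positivity)]
    nlinarith
  refine ⟨L'.extendOfNorm L, fun x ↦ ?_⟩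
  have h := LinearMap.extendOfNorm_eq hdense ⟨_, hnorm⟩ (Finsupp.single x 1)
  simpa [L, L'] using h

theorem HypTotal.continuousLinearMap_ext {M : Type*} [TopologicalSpace M] [T2Space M]
    [AddCommMonoid M] [Module ℝ M] {X : Type*} {f : X → ℝ × H} (hf : HypTotal H (Set.range f))
    {S T : (ℝ × H) →L[ℝ] M} (h : ∀ x, S (f x) = T (f x)) : S = T := by
  rw [HypTotal, ← Submodule.dense_iff_topologicalClosure_eq_top] at hf
  refine ContinuousLinearMap.ext_on hf ?_
  rintro _ ⟨x, rfl⟩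
  exact h x

theorem HypTotal.minkB_map_map {X : Type*} {f : X → ℝ × H} (hf : HypTotal H (Set.range f))
    {T : (ℝ × H) →L[ℝ] (ℝ × H)}
    (hT : ∀ x y, minkB H (T (f x)) (T (f y)) = minkB H (f x) (f y)) (v w : ℝ × H) :
    minkB H (T v) (T w) = minkB H v w := by
  let β (w : ℝ × H) : (ℝ × H) →L[ℝ] ℝ :=
    ⟨(minkBilin H).flip w, continuous_id.minkB continuous_const⟩
  have h1 (y : X) (v : ℝ × H) : minkB H (T v) (T (f y)) = minkB H v (f y) :=
    DFunLike.congr_fun (hf.continuousLinearMap_ext (S := (β (T (f y))).comp T) (T := β (f y))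
      fun x ↦ hT x y) v
  refine DFunLike.congr_fun
    (hf.continuousLinearMap_ext (S := (β (T w)).comp T) (T := β w) fun x ↦ ?_) v
  change minkB H (T (f x)) (T w) = minkB H (f x) w
  rw [minkB_comm, h1, minkB_comm]

/-- An action on a total subset of the hyperboloid that preserves the Minkowski Gram matrix is
induced by a representation into the isometry group. -/
theorem exists_monoidHom_Oplus_of_minkB_smul [CompleteSpace H] {G X : Type*} [Group G]
    [MulAction G X] {f : X → ℝ × H} (hf : HypTotal H (Set.range f)) (hfH : ∀ x, f x ∈ Hyp H)
    (hB : ∀ (g : G) x y, minkB H (f (g • x)) (f (g • y)) = minkB H (f x) (f y))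
    {o : X} (ho : f o = (1, 0)) :
    ∃ ρ : G →* Oplus H, ∀ g x, f (g • x) = (ρ g).1 (f x) := by
  have hw (g : G) (v : X) : (f (g • v)).1 = minkB H (f v) (f (g⁻¹ • o)) := by
    rw [← hB g, smul_inv_smul, ho, minkB_one_zero]
  choose T hT using fun g : G ↦ exists_continuousLinearMap_of_minkB_eq hf (hB g) (hw g)
  have hmul (g h : G) : (T g).comp (T h) = T (g * h) :=
    hf.continuousLinearMap_ext fun x ↦ by simp [hT, mul_smul]
  have hone : T 1 = ContinuousLinearMap.id ℝ _ :=
    hf.continuousLinearMap_ext fun x ↦ by simp [hT]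
  have hinv (g : G) (v : ℝ × H) : T g⁻¹ (T g v) = v := by
    rw [← ContinuousLinearMap.comp_apply, hmul, inv_mul_cancel, hone]; rfl
  have hTB (g : G) : ∀ v w, minkB H (T g v) (T g w) = minkB H v w :=
    hf.minkB_map_map fun x y ↦ by rw [hT, hT, hB]
  have hmaps (g : G) {v : ℝ × H} (hv : v ∈ Hyp H) : T g v ∈ Hyp H := by
    refine ⟨(hTB g v v).trans hv.1, ?_⟩
    rw [← minkB_one_zero, ← ho, ← smul_inv_smul g o, ← hT, hTB]
    exact minkB_pos hv (hfH _)
  let E (g : G) : (ℝ × H) ≃L[ℝ] (ℝ × H) :=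
    .equivOfInverse (T g) (T g⁻¹) (hinv g) fun v ↦ by simpa using hinv g⁻¹ v
  refine ⟨MonoidHom.mk' (fun g ↦ ⟨E g, hTB g, fun v ↦ ⟨hmaps g, fun hv ↦ ?_⟩⟩) fun g h ↦ ?_,
    fun g x ↦ (hT g x).symm⟩
  · exact hinv g v ▸ hmaps g⁻¹ hv
  · refine Subtype.ext (ContinuousLinearEquiv.ext ?_)
    exact funext fun v ↦ (DFunLike.congr_fun (hmul g h) v).symm

/-- The isometry group acts on the hyperboloid. -/
instance : MulAction (Oplus H) (Hyp H) where
  smul g x := ⟨g.1 x, (g.2.2 x).mp x.2⟩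
  one_smul _ := rfl
  mul_smul _ _ _ := rfl

theorem coe_Oplus_smul (g : Oplus H) (x : Hyp H) : ((g • x : Hyp H) : ℝ × H) = g.1 x := rfl

theorem exists_powKernel_embedding [CompleteSpace H] [SeparableSpace H]
    (hinf : ¬ FiniteDimensional ℝ H) {t : ℝ} (ht0 : 0 < t) (ht1 : t ≤ 1) :
    ∃ f : Hyp H → ℝ × H, (∀ x, f x ∈ Hyp H) ∧
      (∀ x y : Hyp H, minkB H (f x) (f y) = minkB H x y ^ t) ∧
      f ⟨(1, 0), one_zero_mem_Hyp⟩ = (1, 0) ∧ HypTotal H (Set.range f) := by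
  obtain ⟨φ, hφ, hspan⟩ := exists_powKernel_feature_map hinf ht0 ht1
  have hB (x y : Hyp H) :
      minkB H (x.1.1 ^ t, φ x) (y.1.1 ^ t, φ y) = minkB H x y ^ t := by
    simp only [minkB, hφ, powKernel, Matrix.of_apply]
    ring
  have hbase : φ ⟨(1, 0), one_zero_mem_Hyp⟩ = 0 := by
    rw [← inner_self_eq_zero (𝕜 := ℝ), hφ]
    simp [powKernel, minkB]
  refine ⟨fun x ↦ (x.1.1 ^ t, φ x), fun x ↦ ⟨?_, Real.rpow_pos_of_pos x.2.2 t⟩, hB, ?_, ?_⟩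
  · rw [hB, x.2.1, Real.one_rpow]
  · simp [hbase]
  · rw [HypTotal, eq_top_iff]
    set S := Submodule.span ℝ (Set.range fun x : Hyp H ↦ (x.1.1 ^ t, φ x))
    have h1 : ((1, 0) : ℝ × H) ∈ S := by
      refine Submodule.subset_span ⟨⟨(1, 0), one_zero_mem_Hyp⟩, ?_⟩
      simp [hbase]
    have h2 : Submodule.span ℝ (Set.range φ) ≤ S.comap (LinearMap.inr ℝ ℝ H) := by
      rw [Submodule.span_le]
      rintro _ ⟨x, rfl⟩
      have hx : (x.1.1 ^ t, φ x) ∈ S := Submodule.subset_span ⟨x, rfl⟩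
      simpa using S.sub_mem hx (S.smul_mem (x.1.1 ^ t) h1)
    have h3 : (⊤ : Submodule ℝ H) ≤
        S.topologicalClosure.comap (ContinuousLinearMap.inr ℝ ℝ H : H →ₗ[ℝ] ℝ × H) := by
      rw [← hspan]
      refine Submodule.topologicalClosure_minimal _
        (h2.trans (Submodule.comap_mono S.le_topologicalClosure)) ?_
      exact S.isClosed_topologicalClosure.preimage (ContinuousLinearMap.inr ℝ ℝ H).continuous
    rintro ⟨a, v⟩ -
    have h4 := S.topologicalClosure.add_mem
      (S.topologicalClosure.smul_mem a (S.le_topologicalClosure h1)) (h3 (Submodule.mem_top (x := v)))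
    simpa using h4

end Minkowski

end

/-- existence of the self-representation `ρ_t^∞` of `O₊(B)` together with an
equivariant map `f` of the hyperboloid satisfying `B (f x) (f y) = (B x y)ᵗ`, with
hyperbolically total image. -/
theorem exists_exotic_self_representation
    (H : Type*) [NormedAddCommGroup H] [InnerProductSpace ℝ H] [CompleteSpace H]
    [TopologicalSpace.SeparableSpace H] (hinf : ¬ FiniteDimensional ℝ H)
    (t : ℝ) (ht0 : 0 < t) (ht1 : t ≤ 1) :
    ∃ (ρ : Oplus H →* Oplus H) (f : ℝ × H → ℝ × H),
      (∀ x ∈ Hyp H, f x ∈ Hyp H) ∧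
      (∀ x ∈ Hyp H, ∀ y ∈ Hyp H, minkB H (f x) (f y) = (minkB H x y) ^ t) ∧
      (∀ g : Oplus H, ∀ x ∈ Hyp H, f (g.1 x) = (ρ g).1 (f x)) ∧
      HypTotal H (f '' Hyp H) := by
  classical
  obtain ⟨f, hfH, hfB, hfo, hf⟩ := exists_powKernel_embedding hinf ht0 ht1
  obtain ⟨ρ, hρ⟩ := exists_monoidHom_Oplus_of_minkB_smul (G := Oplus H) hf hfH
    (fun g x y ↦ by rw [hfB, hfB, coe_Oplus_smul, coe_Oplus_smul, g.2.1]) hfo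
  have hF {x : ℝ × H} (hx : x ∈ Hyp H) :
      (if h : x ∈ Hyp H then f ⟨x, h⟩ else 0) = f ⟨x, hx⟩ := dif_pos hx
  refine ⟨ρ, fun x ↦ if h : x ∈ Hyp H then f ⟨x, h⟩ else 0, fun x hx ↦ ?_, fun x hx y hy ↦ ?_,
    fun g x hx ↦ ?_, ?_⟩
  · simpa only [hF hx] using hfH _
  · simpa only [hF hx, hF hy] using hfB _ _
  · simp only [hF hx, hF ((g.2.2 x).mp hx)]
    exact hρ g ⟨x, hx⟩
  · convert hf using 1
    ext v
    constructor
    · rintro ⟨x, hx, rfl⟩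
      exact ⟨⟨x, hx⟩, (hF hx).symm⟩
    · rintro ⟨x, rfl⟩
      exact ⟨x, x.2, hF x.2⟩
end

section
/- Let H be a real Hilbert space, 0 < t ≤ 1, and let f : ℋ(H) → ℋ(H') be any map into a hyperboloid ℋ(H') satisfying cosh d(f(x), f(y)) = (cosh d(x,y))^t, i.e. B'(f(x), f(y)) = (B(x,y))^t, for all x, y ∈ ℋ(H). Then for all x, y ∈ ℋ(H): 0 ≤ d(f(x), f(y)) − t·d(x,y) ≤ (1 − t)·log 2. Equivalently, for all u ≥ 0 one has t·u ≤ arcosh((cosh u)^t) ≤ t·u + (1 − t)·log 2. -/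
open scoped RealInnerProductSpace

variable (H : Type*) [NormedAddCommGroup H] [InnerProductSpace ℝ H]

theorem one_le_minkB {H : Type*} [NormedAddCommGroup H] [InnerProductSpace ℝ H]
    {x y : ℝ × H} (hx : x ∈ Hyp H) (hy : y ∈ Hyp H) : 1 ≤ minkB H x y := by
  obtain ⟨hx1, hx0⟩ := hx
  obtain ⟨hy1, hy0⟩ := hy
  simp only [minkB, real_inner_self_eq_norm_sq] at hx1 hy1 ⊢
  have hxy := real_inner_le_norm x.2 y.2
  have hsq : (1 + ‖x.2‖ * ‖y.2‖) ^ 2 ≤ (x.1 * y.1) ^ 2 := by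
    have : (x.1 * y.1) ^ 2 = (1 + ‖x.2‖ ^ 2) * (1 + ‖y.2‖ ^ 2) := by
      rw [show 1 + ‖x.2‖ ^ 2 = x.1 * x.1 by linarith,
        show 1 + ‖y.2‖ ^ 2 = y.1 * y.1 by linarith]
      ring
    rw [this]
    nlinarith [sq_nonneg (‖x.2‖ - ‖y.2‖)]
  have := (sq_le_sq₀ (by positivity) (by positivity)).1 hsq
  linarith

theorem cosh_mul_le_cosh_rpow {t : ℝ} (ht0 : 0 ≤ t) (ht1 : t ≤ 1) (u : ℝ) :
    Real.cosh (t * u) ≤ Real.cosh u ^ t := by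
  have h := (Real.concaveOn_rpow ht0 ht1).2 (Real.exp_pos u).le (Real.exp_pos (-u)).le
    (show (0 : ℝ) ≤ 1 / 2 by norm_num) (show (0 : ℝ) ≤ 1 / 2 by norm_num) (by norm_num)
  simp only [smul_eq_mul, ← Real.exp_mul] at h
  rw [Real.cosh_eq, Real.cosh_eq u]
  calc (Real.exp (t * u) + Real.exp (-(t * u))) / 2
      = 1 / 2 * Real.exp (u * t) + 1 / 2 * Real.exp (-u * t) := by ring_nf
    _ ≤ _ := h
    _ = ((Real.exp u + Real.exp (-u)) / 2) ^ t := by congr 1; ring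

/-- The function `u ↦ u - log (cosh u)` is monotone. -/
theorem sub_log_cosh_mono {w u : ℝ} (h : w ≤ u) :
    w - Real.log (Real.cosh w) ≤ u - Real.log (Real.cosh u) := by
  have key : Real.exp w * Real.cosh u ≤ Real.exp u * Real.cosh w := by
    have h1 : Real.exp (w + -u) ≤ Real.exp (u + -w) := Real.exp_le_exp.2 (by linarith)
    rw [Real.exp_add, Real.exp_add] at h1
    rw [Real.cosh_eq, Real.cosh_eq]
    nlinarith
  have := Real.log_le_log (mul_pos (Real.exp_pos w) (Real.cosh_pos u)) key
  rw [Real.log_mul (Real.exp_pos _).ne' (Real.cosh_pos _).ne',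
    Real.log_mul (Real.exp_pos _).ne' (Real.cosh_pos _).ne', Real.log_exp, Real.log_exp] at this
  linarith

theorem sub_log_cosh_le_log_two (u : ℝ) : u - Real.log (Real.cosh u) ≤ Real.log 2 := by
  have key : Real.exp u ≤ 2 * Real.cosh u := by
    rw [Real.cosh_eq]
    linarith [Real.exp_pos (-u)]
  have := Real.log_le_log (Real.exp_pos u) key
  rw [Real.log_exp, Real.log_mul two_ne_zero (Real.cosh_pos _).ne'] at this
  linarith

theorem arcosh_cosh_rpow_bounds {t : ℝ} (ht0 : 0 ≤ t) (ht1 : t ≤ 1) {u : ℝ} (hu : 0 ≤ u) :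
    t * u ≤ arcosh (Real.cosh u ^ t) ∧
      arcosh (Real.cosh u ^ t) ≤ t * u + (1 - t) * Real.log 2 := by
  change t * u ≤ Real.arcosh (Real.cosh u ^ t) ∧
    Real.arcosh (Real.cosh u ^ t) ≤ t * u + (1 - t) * Real.log 2
  have hc : 1 ≤ Real.cosh u := Real.one_le_cosh u
  have hct : 1 ≤ Real.cosh u ^ t := Real.one_le_rpow hc ht0
  constructor
  · rw [← Real.arcosh_cosh (mul_nonneg ht0 hu)]
    exact (Real.arcosh_le_arcosh (Real.cosh_pos _) (by linarith)).2
      (cosh_mul_le_cosh_rpow ht0 ht1 u)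
  · set w := Real.arcosh (Real.cosh u ^ t) with hw
    have hwu : w ≤ u := by
      rw [hw]
      conv_rhs => rw [← Real.arcosh_cosh hu]
      refine (Real.arcosh_le_arcosh (by linarith) (Real.cosh_pos _)).2 ?_
      simpa using Real.rpow_le_rpow_of_exponent_le hc ht1
    have h := sub_log_cosh_mono hwu
    rw [hw, Real.cosh_arcosh hct, ← hw, Real.log_rpow (Real.cosh_pos u)] at h
    nlinarith [mul_le_mul_of_nonneg_left (sub_log_cosh_le_log_two u) (sub_nonneg.2 ht1)]

/-- a map between hyperboloids with `cosh d(f x, f y) = (cosh d(x,y))ᵗ`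
is a rescaled isometry up to an additive error `(1-t) log 2`; equivalently
`t u ≤ arcosh((cosh u)ᵗ) ≤ t u + (1-t) log 2` for all `u ≥ 0`. -/
theorem almost_isometry
    (H : Type*) [NormedAddCommGroup H] [InnerProductSpace ℝ H] [CompleteSpace H]
    (H' : Type*) [NormedAddCommGroup H'] [InnerProductSpace ℝ H'] [CompleteSpace H']
    (t : ℝ) (ht0 : 0 < t) (ht1 : t ≤ 1)
    (f : ℝ × H → ℝ × H') (hf : ∀ x ∈ Hyp H, f x ∈ Hyp H')
    (hpow : ∀ x ∈ Hyp H, ∀ y ∈ Hyp H, minkB H' (f x) (f y) = (minkB H x y) ^ t) :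
    (∀ x ∈ Hyp H, ∀ y ∈ Hyp H,
      0 ≤ hypDist H' (f x) (f y) - t * hypDist H x y ∧
      hypDist H' (f x) (f y) - t * hypDist H x y ≤ (1 - t) * Real.log 2) ∧
    (∀ u : ℝ, 0 ≤ u →
      t * u ≤ arcosh ((Real.cosh u) ^ t) ∧
      arcosh ((Real.cosh u) ^ t) ≤ t * u + (1 - t) * Real.log 2) := by
  refine ⟨fun x hx y hy => ?_, fun u hu => arcosh_cosh_rpow_bounds ht0.le ht1 hu⟩
  have hB := one_le_minkB hx hy
  have h := arcosh_cosh_rpow_bounds ht0.le ht1 (Real.arcosh_nonneg hB)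
  rw [Real.cosh_arcosh hB, ← hpow x hx y hy] at h
  change t * hypDist H x y ≤ hypDist H' (f x) (f y) ∧
    hypDist H' (f x) (f y) ≤ t * hypDist H x y + (1 - t) * Real.log 2 at h
  exact ⟨by linarith [h.1], by linarith [h.2]⟩
end
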